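/- Let A ⊆ ℂ be open and let γ : [0,1] → A be a simple closed curve (a continuous loop with γ(0) = γ(1) that is injective on [0,1)). If every bounded connected component of ℂ \ γ([0,1]) is contained in A, then γ is null-homotopic in A. -/

import Mathlib

/-- Edge labels `H` (horizontal) and `V` (vertical) of the quadrant grid with values in a group
have trivial holonomy around the unit square with lower left corner `q`. -/
def FlatAt {G : Type*} [Group G] (H V : ℕ × ℕ → G) (q : ℕ × ℕ) : Prop :=
  V (q.1 + 1, q.2) * H q = H (q.1, q.2 + 1) * V q

/-- Every labelling of the edges of the quadrant grid that is flat at all squares outside `D` is a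
coboundary on the edges of the squares outside `D`. -/
def FlatExact (G : Type*) [Group G] (D : Set (ℕ × ℕ)) : Prop :=
  ∀ H V : ℕ × ℕ → G, (∀ q ∉ D, FlatAt H V q) → ∃ h : ℕ × ℕ → G, ∀ q ∉ D,
    h (q.1 + 1, q.2) = H q * h q ∧ h (q.1, q.2 + 1) = V q * h q

/-- Two squares of the quadrant grid share an edge. -/
def SquareAdj (p q : ℕ × ℕ) : Prop :=
  p = (q.1 + 1, q.2) ∨ p = (q.1, q.2 + 1) ∨ q = (p.1 + 1, p.2) ∨ q = (p.1, p.2 + 1)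

theorem flatExact_empty (G : Type*) [Group G] : FlatExact G ∅ := by
  intro H V hflat
  let row : ℕ → G := fun i => Nat.rec 1 (fun i x => H (i, 0) * x) i
  let h : ℕ → ℕ → G := fun i j => Nat.rec (row i) (fun j x => V (i, j) * x) j
  have hV : ∀ i j, h i (j + 1) = V (i, j) * h i j := fun i j => rfl
  have hH : ∀ i j, h (i + 1) j = H (i, j) * h i j := by
    intro i j
    induction j with
    | zero => rfl
    | succ j ih =>
      have hf : V (i + 1, j) * H (i, j) = H (i, j + 1) * V (i, j) := hflat (i, j) (by simp)
      rw [hV, ih, hV, ← mul_assoc, hf, mul_assoc]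
  exact ⟨fun q => h q.1 q.2, fun q _ => ⟨hH _ _, hV _ _⟩⟩

/-- If every labelling can be made flat at `q` without changing the edges of the squares outside
`insert q D`, then `q` can be added to `D`. -/
theorem FlatExact.of_modify {G : Type*} [Group G] {D : Set (ℕ × ℕ)} (hD : FlatExact G D)
    (q : ℕ × ℕ)
    (hmod : ∀ H V : ℕ × ℕ → G, ∃ H' V' : ℕ × ℕ → G, FlatAt H' V' q ∧ ∀ r ∉ insert q D,
      H' r = H r ∧ V' r = V r ∧ H' (r.1, r.2 + 1) = H (r.1, r.2 + 1) ∧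
        V' (r.1 + 1, r.2) = V (r.1 + 1, r.2)) :
    FlatExact G (insert q D) := by
  intro H V hflat
  obtain ⟨H', V', hq, hr⟩ := hmod H V
  obtain ⟨h, hh⟩ := hD H' V' (by
    intro r hrD
    by_cases hrq : r = q
    · exact hrq ▸ hq
    · have hr' : r ∉ insert q D := by simp [hrq, hrD]
      obtain ⟨h1, h2, h3, h4⟩ := hr r hr'
      have := hflat r hr'
      unfold FlatAt at this ⊢
      rw [h1, h2, h3, h4, this])
  refine ⟨h, fun r hr' => ?_⟩
  obtain ⟨h1, h2, -, -⟩ := hr r hr'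
  rw [← h1, ← h2]
  exact hh r fun hrD => hr' (Set.mem_insert_of_mem _ hrD)

theorem flatExact_singleton_zero (G : Type*) [Group G] : FlatExact G {((0, 0) : ℕ × ℕ)} := by
  rw [← insert_empty_eq]
  refine (flatExact_empty G).of_modify _ fun H V => ⟨H,
    Function.update V (0, 0) ((H (0, 1))⁻¹ * V (1, 0) * H (0, 0)), ?_, ?_⟩
  · simp [FlatAt, mul_assoc]
  · rintro ⟨i, j⟩ hr
    simp only [insert_empty_eq, Set.mem_singleton_iff] at hr
    simp [hr]

theorem FlatExact.insert {G : Type*} [Group G] {D : Set (ℕ × ℕ)} (hD : FlatExact G D)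
    {p q : ℕ × ℕ} (hp : p ∈ D) (hpq : SquareAdj p q) : FlatExact G (insert q D) := by
  refine hD.of_modify q fun H V => ?_
  obtain ⟨i, j⟩ := q
  have key : ∀ r ∉ Insert.insert (i, j) D, r ≠ (i, j) ∧ r ≠ p := by
    rintro r hr
    refine ⟨?_, ?_⟩ <;> rintro rfl <;> simp_all
  rcases hpq with rfl | rfl | h | h
  · refine ⟨H, Function.update V (i + 1, j) (H (i, j + 1) * V (i, j) * (H (i, j))⁻¹), ?_, ?_⟩
    · simp [FlatAt]
    · rintro ⟨a, b⟩ hr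
      have := key _ hr
      simp_all
  · refine ⟨Function.update H (i, j + 1) (V (i + 1, j) * H (i, j) * (V (i, j))⁻¹), V, ?_, ?_⟩
    · simp [FlatAt]
    · rintro ⟨a, b⟩ hr
      have := key _ hr
      simp_all
  · refine ⟨H, Function.update V (i, j) ((H (i, j + 1))⁻¹ * V (i + 1, j) * H (i, j)), ?_, ?_⟩
    · simp [FlatAt, mul_assoc]
    · rintro ⟨a, b⟩ hr
      have := key _ hr
      obtain ⟨c, d⟩ := p
      simp_all
  · refine ⟨Function.update H (i, j) ((V (i + 1, j))⁻¹ * H (i, j + 1) * V (i, j)), V, ?_, ?_⟩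
    · simp [FlatAt, mul_assoc]
    · rintro ⟨a, b⟩ hr
      have := key _ hr
      obtain ⟨c, d⟩ := p
      simp_all

/-- A finite edge-connected set of squares containing the corner square is `FlatExact`. -/
theorem flatExact_of_connected (G : Type*) [Group G] {Q : Set (ℕ × ℕ)} (hfin : Q.Finite)
    (h0 : ((0, 0) : ℕ × ℕ) ∈ Q)
    (hconn : ∀ D ⊆ Q, ((0, 0) : ℕ × ℕ) ∈ D → D ≠ Q → ∃ p ∈ D, ∃ q ∈ Q \ D, SquareAdj p q) :
    FlatExact G Q := by
  have hfinS : {D : Set (ℕ × ℕ) | D ⊆ Q ∧ (0, 0) ∈ D ∧ FlatExact G D}.Finite :=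
    hfin.finite_subsets.subset fun D hD => hD.1
  obtain ⟨D, hD⟩ := hfinS.exists_maximal ⟨{(0, 0)}, by
    exact ⟨by simpa using h0, rfl, flatExact_singleton_zero G⟩⟩
  obtain ⟨⟨hDQ, hD0, hDG⟩, hmax⟩ := hD
  by_contra hQ
  obtain ⟨p, hp, q, hq, hpq⟩ := hconn D hDQ hD0 (by rintro rfl; exact hQ hDG)
  exact hq.2 (hmax ⟨Set.insert_subset hq.1 hDQ, Set.mem_insert_of_mem _ hD0, hDG.insert hp hpq⟩
    (Set.subset_insert _ _) (Set.mem_insert _ _))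

/-- A compact subset of a connected open set of a normed space lies in a compact connected subset
of that open set. -/
theorem IsOpen.exists_isCompact_isConnected_superset {E : Type*} [NormedAddCommGroup E]
    [NormedSpace ℝ E] [FiniteDimensional ℝ E] {U C : Set E} (hU : IsOpen U) (hUc : IsConnected U)
    (hC : IsCompact C) (hCU : C ⊆ U) : ∃ L, IsCompact L ∧ IsConnected L ∧ C ⊆ L ∧ L ⊆ U := by
  have hUp : IsPathConnected U := hU.isConnected_iff_isPathConnected.1 hUc
  obtain ⟨x₀, hx₀⟩ := hUc.nonempty
  suffices h : ∃ L, IsCompact L ∧ IsConnected L ∧ x₀ ∈ L ∧ C ⊆ L ∧ L ⊆ U by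
    obtain ⟨L, h1, h2, -, h3, h4⟩ := h
    exact ⟨L, h1, h2, h3, h4⟩
  refine hC.induction_on
    (p := fun S => ∃ L, IsCompact L ∧ IsConnected L ∧ x₀ ∈ L ∧ S ⊆ L ∧ L ⊆ U) ?_ ?_ ?_ ?_
  · exact ⟨{x₀}, isCompact_singleton, isConnected_singleton, rfl, by simp, by simpa using hx₀⟩
  · rintro S T hST ⟨L, h1, h2, h3, h4, h5⟩
    exact ⟨L, h1, h2, h3, hST.trans h4, h5⟩
  · rintro S T ⟨L, h1, h2, h3, h4, h5⟩ ⟨L', h1', h2', h3', h4', h5'⟩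
    exact ⟨L ∪ L', h1.union h1', h2.union ⟨x₀, h3, h3'⟩ h2', .inl h3,
      Set.union_subset_union h4 h4', Set.union_subset h5 h5'⟩
  · intro x hx
    obtain ⟨r, hr, hrU⟩ := Metric.nhds_basis_closedBall.mem_iff.1 (hU.mem_nhds (hCU hx))
    obtain ⟨p, hp⟩ := hUp.joinedIn x₀ hx₀ x (hCU hx)
    refine ⟨Metric.closedBall x r, mem_nhdsWithin_of_mem_nhds (Metric.closedBall_mem_nhds x hr),
      Set.range p ∪ Metric.closedBall x r,
      (isCompact_range p.continuous).union (isCompact_closedBall x r),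
      (isConnected_range p.continuous).union ⟨x, ⟨1, p.target⟩, Metric.mem_closedBall_self hr.le⟩
        ((convex_closedBall x r).isConnected ⟨x, Metric.mem_closedBall_self hr.le⟩),
      .inl ⟨0, p.source⟩, Set.subset_union_right,
      Set.union_subset (Set.range_subset_iff.2 hp) hrU⟩

theorem Complex.isPreconnected_setOf_lt_norm {R : ℝ} (hR : 0 < R) :
    IsPreconnected {z : ℂ | R < ‖z‖} := by
  have h : {z : ℂ | R < ‖z‖} = Complex.exp '' {w : ℂ | Real.log R < w.re} := by
    ext z
    constructor
    · intro hz
      have hz' : R < ‖z‖ := hz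
      have hz0 : z ≠ 0 := norm_pos_iff.1 (hR.trans hz')
      exact ⟨Complex.log z, by simpa [Complex.log_re] using Real.log_lt_log hR hz',
        Complex.exp_log hz0⟩
    · rintro ⟨w, hw, rfl⟩
      simpa [Complex.norm_exp] using (Real.log_lt_iff_lt_exp hR).1 hw
  rw [h]
  exact (convex_halfSpace_re_gt _).isPreconnected.image _ Complex.continuous_exp.continuousOn

/-- The unbounded component of the complement of `K` contains everything outside `A`, if `A`
contains `K` and the bounded components of its complement. -/
theorem exists_unbounded_component {A K : Set ℂ} (hK : IsCompact K) (hKA : K ⊆ A)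
    (hcomp : ∀ z ∉ K, Bornology.IsBounded (connectedComponentIn Kᶜ z) →
      connectedComponentIn Kᶜ z ⊆ A) :
    ∃ U : Set ℂ, IsOpen U ∧ IsConnected U ∧ U ⊆ Kᶜ ∧ Aᶜ ⊆ U ∧ Bornology.IsBounded Uᶜ := by
  obtain ⟨R, hR, hKR⟩ := hK.isBounded.subset_closedBall_lt 0 0
  have hout : {z : ℂ | R < ‖z‖} ⊆ Kᶜ := fun z hz hzK => by
    have := hKR hzK
    simp only [Metric.mem_closedBall, dist_zero_right] at this
    exact absurd hz (not_lt.2 this)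
  have hz₀ : ((R + 1 : ℝ) : ℂ) ∈ {z : ℂ | R < ‖z‖} := by
    simp only [Set.mem_ofPred_eq, Complex.norm_real, Real.norm_eq_abs]
    exact (lt_add_one R).trans_le (le_abs_self _)
  have hU := (Complex.isPreconnected_setOf_lt_norm hR).subset_connectedComponentIn hz₀ hout
  refine ⟨connectedComponentIn Kᶜ ((R + 1 : ℝ) : ℂ), hK.isClosed.isOpen_compl.connectedComponentIn,
    isConnected_connectedComponentIn_iff.2 (hout hz₀), connectedComponentIn_subset _ _, ?_, ?_⟩
  · intro z hz
    have hzK : z ∉ K := fun h => hz (hKA h)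
    have hnb : ¬ Bornology.IsBounded (connectedComponentIn Kᶜ z) := fun hb =>
      hz (hcomp z hzK hb (mem_connectedComponentIn hzK))
    obtain ⟨w, hw, hwR⟩ : ∃ w ∈ connectedComponentIn Kᶜ z, R < ‖w‖ := by
      by_contra! hcon
      exact hnb (isBounded_iff_forall_norm_le.2 ⟨R, hcon⟩)
    rw [connectedComponentIn_eq (hU hwR), ← connectedComponentIn_eq hw]
    exact mem_connectedComponentIn hzK
  · refine isBounded_iff_forall_norm_le.2 ⟨R, fun z hz => ?_⟩
    by_contra! hcon
    exact hz (hU hcon)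

/-- The fundamental groupoid of `X` admits a multiplicative map to the fundamental group at `x₀`
that detects the trivial loop at `x₀`. -/
theorem exists_groupoid_hom_fundamentalGroup {X : Type*} [TopologicalSpace X] (x₀ : X) :
    ∃ lab : ∀ u v : X, Path.Homotopic.Quotient u v → FundamentalGroup X x₀,
      (∀ u v w (p : Path.Homotopic.Quotient u v) (q : Path.Homotopic.Quotient v w),
        lab u w (p.trans q) = lab v w q * lab u v p) ∧
      ∀ p : Path.Homotopic.Quotient x₀ x₀, lab x₀ x₀ p = 1 → p = .refl x₀ := by
  classical
  refine ⟨fun u v p => if h : Joined x₀ u ∧ Joined x₀ v then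
    (Path.Homotopic.Quotient.mk h.1.somePath).trans
      (p.trans (Path.Homotopic.Quotient.mk h.2.somePath).symm) else 1, ?_, ?_⟩
  · intro u v w p q
    have huv : Joined u v := ⟨p.exists_rep.choose⟩
    have hvw : Joined v w := ⟨q.exists_rep.choose⟩
    by_cases h : Joined x₀ u
    · have hv := h.trans huv
      have hw := hv.trans hvw
      simp only [h, hv, hw, and_self, dite_true, FundamentalGroup.mul_def]
      simp only [Path.Homotopic.Quotient.trans_assoc]
      congr 2
      rw [← Path.Homotopic.Quotient.trans_assoc (Path.Homotopic.Quotient.symm _)]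
      simp
    · have hv : ¬ Joined x₀ v := fun hv => h (hv.trans huv.symm)
      simp [h, hv]
  · intro p hp
    have h : Joined x₀ x₀ := .refl x₀
    simp only [h, and_self, dite_true, FundamentalGroup.one_def] at hp
    set c := Path.Homotopic.Quotient.mk h.somePath
    have hconj := congrArg (fun x => (c.symm.trans x).trans c) hp
    simp only [Path.Homotopic.Quotient.trans_assoc] at hconj
    simpa [← Path.Homotopic.Quotient.trans_assoc c.symm] using hconj

/-- Paths with values in a common convex subset and with the same endpoints are homotopic. -/
theorem Path.homotopic_of_mem_convex {A C : Set ℂ} (hCA : C ⊆ A) (hC : Convex ℝ C) {u v : A}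
    (p q : Path u v) (hp : ∀ t, (p t : ℂ) ∈ C) (hq : ∀ t, (q t : ℂ) ∈ C) : p.Homotopic q := by
  have hu : (u : ℂ) ∈ C := by simpa using hp 0
  have hv : (v : ℂ) ∈ C := by simpa using hp 1
  have : ContractibleSpace C := hC.contractibleSpace ⟨u, hu⟩
  let lift : ∀ r : Path u v, (∀ t, (r t : ℂ) ∈ C) → Path (⟨u, hu⟩ : C) ⟨v, hv⟩ := fun r hr =>
    { toFun := fun t => ⟨r t, hr t⟩
      continuous_toFun := by fun_prop
      source' := by simp
      target' := by simp }
  obtain ⟨F⟩ := SimplyConnectedSpace.paths_homotopic (lift p hp) (lift q hq)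
  exact ⟨F.map ⟨Set.inclusion hCA, continuous_inclusion hCA⟩⟩

/-- A loop in `A ⊆ ℂ` is null-homotopic as soon as every locally defined transport along straight
segments of `A`, with values in a group, has a potential along the loop. -/
theorem Path.homotopic_refl_of_exists_potential {A : Set ℂ} (hA : IsOpen A) {a : A} (γ : Path a a)
    (hpot : ∀ ℓ : ℂ → ℂ → FundamentalGroup A a,
      (∀ C ⊆ A, Convex ℝ C → ∀ u ∈ C, ∀ v ∈ C, ∀ w ∈ C, ℓ u w = ℓ v w * ℓ u v) →
      ∃ φ : ℂ → FundamentalGroup A a, ∃ ε > 0, ∀ s t, dist (γ s : ℂ) (γ t) < ε →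
        φ (γ t) = ℓ (γ s) (γ t) * φ (γ s)) :
    γ.Homotopic (Path.refl a) := by
  classical
  obtain ⟨lab, hmul, hinj⟩ := exists_groupoid_hom_fundamentalGroup a
  let seg : ∀ u v : ℂ, ∀ h : segment ℝ u v ⊆ A,
      Path (⟨u, h (left_mem_segment ℝ u v)⟩ : A) ⟨v, h (right_mem_segment ℝ u v)⟩ := fun u v h =>
    { toFun := fun t => ⟨Path.segment u v t, h (Path.range_segment u v ▸ Set.mem_range_self t)⟩
      continuous_toFun := by fun_prop
      source' := by simp
      target' := by simp }
  have hseg : ∀ {C : Set ℂ}, Convex ℝ C → ∀ {u v}, u ∈ C → v ∈ C → ∀ h t, (seg u v h t : ℂ) ∈ C :=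
    fun {C} hC {u v} hu hv h t => hC.segment_subset hu hv
      (Path.range_segment u v ▸ Set.mem_range_self t)
  let ℓ : ℂ → ℂ → FundamentalGroup A a := fun u v =>
    if h : segment ℝ u v ⊆ A then lab _ _ (.mk (seg u v h)) else 1
  have hℓ : ∀ {C : Set ℂ}, C ⊆ A → Convex ℝ C → ∀ {u v : A} (p : Path u v),
      (∀ t, (p t : ℂ) ∈ C) → ℓ u v = lab u v (.mk p) := by
    intro C hCA hC u v p hp
    have hu : (u : ℂ) ∈ C := by simpa using hp 0
    have hv : (v : ℂ) ∈ C := by simpa using hp 1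
    have h : segment ℝ (u : ℂ) v ⊆ A := (hC.segment_subset hu hv).trans hCA
    simp only [ℓ, h, dite_true]
    exact congrArg _ (Path.Homotopic.Quotient.eq.2
      (Path.homotopic_of_mem_convex hCA hC _ _ (hseg hC hu hv h) hp))
  obtain ⟨φ, ε, hε, hφ⟩ := hpot ℓ (by
    intro C hCA hC u hu v hv w hw
    have huv := (hC.segment_subset hu hv).trans hCA
    have hvw := (hC.segment_subset hv hw).trans hCA
    have h1 := hℓ hCA hC (seg u v huv) (hseg hC hu hv huv)
    have h2 := hℓ hCA hC (seg v w hvw) (hseg hC hv hw hvw)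
    have h3 := hℓ hCA hC ((seg u v huv).trans (seg v w hvw)) (by
      intro t
      rw [Path.trans_apply]
      split_ifs
      exacts [hseg hC hu hv _ _, hseg hC hv hw _ _])
    rw [Path.Homotopic.Quotient.mk_trans, hmul] at h3
    exact h3.trans (by rw [← h1, ← h2]))
  let m : ∀ s t, FundamentalGroup A a := fun s t => lab _ _ (.mk (γ.subpath s t))
  have hm : ∀ r s t, m r t = m s t * m r s := by
    intro r s t
    simp only [m]
    rw [← hmul, ← Path.Homotopic.Quotient.mk_trans]
    exact congrArg _
      (Path.Homotopic.Quotient.eq.2 ⟨(Path.Homotopy.subpathTransSubpath γ r s t).symm⟩)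
  have hlc : IsLocallyConstant fun t => (m 0 t)⁻¹ * φ (γ t) := by
    rw [IsLocallyConstant.iff_eventually_eq]
    intro s
    obtain ⟨η, hη, hηA⟩ := Metric.isOpen_iff.1 hA (γ s) (γ s).2
    have hcont : Continuous fun t => (γ t : ℂ) := by fun_prop
    obtain ⟨d, hd, hdγ⟩ := Metric.continuous_iff.1 hcont s (min η ε) (lt_min hη hε)
    filter_upwards [Metric.ball_mem_nhds s hd] with t ht
    have hst : ∀ r ∈ Set.uIcc s t, dist r s < d := by
      intro r hr
      refine lt_of_le_of_lt ?_ (Metric.mem_ball'.1 ht)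
      rw [Subtype.dist_eq, Subtype.dist_eq, dist_comm]
      refine Real.dist_left_le_of_mem_uIcc ?_
      rw [Set.mem_uIcc] at hr ⊢
      exact hr
    have h1 : ℓ (γ s) (γ t) = m s t := by
      refine hℓ hηA (convex_ball _ _) _ fun x => ?_
      have : γ.subpath s t x ∈ γ '' Set.uIcc s t := by
        rw [← Path.range_subpath]; exact Set.mem_range_self x
      obtain ⟨r, hr, hrx⟩ := this
      rw [← hrx]
      exact (hdγ r (hst r hr)).trans_le (min_le_left _ _)
    have h2 := hφ s t (by
      rw [dist_comm]
      exact (hdγ t ht).trans_le (min_le_right _ _))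
    rw [h2, h1, hm 0 s t]
    group
  have h01 := hlc.apply_eq_of_isPreconnected isPreconnected_univ (Set.mem_univ 0) (Set.mem_univ 1)
  have h00 : m 0 0 = 1 := left_eq_mul.1 (hm 0 0 0)
  have hm1 : m 0 1 = lab a a (.mk γ) := by
    have hcast : ∀ u v (hu : u = a) (hv : v = a),
        lab u v (.mk (γ.cast hu hv)) = lab a a (.mk γ) := by
      rintro _ _ rfl rfl
      rfl
    simp only [m, Path.subpath_zero_one]
    exact hcast _ _ γ.source γ.target
  simp only [h00, γ.source, γ.target, hm1] at h01
  have hγ : lab a a (.mk γ) = 1 :=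
    inv_eq_one.1 (mul_eq_right.1 (h01.symm.trans (by rw [inv_one, one_mul])))
  exact Path.Homotopic.Quotient.eq.1 (hinj _ hγ)

/-- The vertex `q` of the square grid of mesh `δ` with origin `(c, c)`. -/
def gridVertex (c δ : ℝ) (q : ℕ × ℕ) : ℂ := ⟨c + δ * q.1, c + δ * q.2⟩

/-- The closed square with lower left corner `gridVertex c δ q`. -/
def gridSquare (c δ : ℝ) (q : ℕ × ℕ) : Set ℂ :=
  Set.Icc (c + δ * q.1) (c + δ * (q.1 + 1)) ×ℂ Set.Icc (c + δ * q.2) (c + δ * (q.2 + 1))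

theorem isClosed_gridSquare (c δ : ℝ) (q : ℕ × ℕ) : IsClosed (gridSquare c δ q) :=
  isClosed_Icc.reProdIm isClosed_Icc

theorem convex_gridSquare (c δ : ℝ) (q : ℕ × ℕ) : Convex ℝ (gridSquare c δ q) :=
  ((convex_Icc (c + δ * q.1) _).linear_preimage Complex.reLm).inter
    ((convex_Icc (c + δ * q.2) _).linear_preimage Complex.imLm)

theorem exists_mem_Icc_grid {c δ x : ℝ} (hδ : 0 < δ) (N : ℕ) (h₁ : c ≤ x)
    (h₂ : x ≤ c + δ * (N + 1)) : ∃ i ≤ N, x ∈ Set.Icc (c + δ * i) (c + δ * (i + 1)) := by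
  have h0 : 0 ≤ (x - c) / δ := div_nonneg (by linarith) hδ.le
  have hfl := Nat.floor_le h0
  have hlt := Nat.lt_floor_add_one ((x - c) / δ)
  rw [le_div_iff₀ hδ] at hfl
  rw [div_lt_iff₀ hδ] at hlt
  rcases le_or_gt ⌊(x - c) / δ⌋₊ N with h | h
  · exact ⟨_, h, by constructor <;> nlinarith⟩
  · refine ⟨N, le_rfl, ?_, h₂⟩
    have : (N : ℝ) ≤ ⌊(x - c) / δ⌋₊ := by exact_mod_cast h.le
    nlinarith

theorem grid_index_le_succ {c δ x : ℝ} (hδ : 0 < δ) {i j : ℕ} (hi : c + δ * i ≤ x)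
    (hj : x ≤ c + δ * (j + 1)) : i ≤ j + 1 := by
  have : δ * i ≤ δ * ((j + 1 : ℕ) : ℝ) := by push_cast; linarith
  exact_mod_cast le_of_mul_le_mul_left this hδ

/-- The grid squares meeting a connected subset of the box form an edge-connected set. -/
theorem exists_squareAdj_of_isPreconnected {c δ : ℝ} (hδ : 0 < δ) (N : ℕ) {L : Set ℂ}
    (hL : IsPreconnected L)
    (hbox : L ⊆ Set.Icc c (c + δ * (N + 1)) ×ℂ Set.Icc c (c + δ * (N + 1)))
    {Q : Set (ℕ × ℕ)} (hQ : Q = {q | (q.1 ≤ N ∧ q.2 ≤ N) ∧ (L ∩ gridSquare c δ q).Nonempty})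
    {D : Set (ℕ × ℕ)} (hDQ : D ⊆ Q) (hD : D.Nonempty) (hne : D ≠ Q) :
    ∃ p ∈ D, ∃ q ∈ Q \ D, SquareAdj p q := by
  have hQfin : Q.Finite := (Set.finite_Iic ((N, N) : ℕ × ℕ)).subset fun q hq => by
    rw [hQ] at hq
    exact Prod.mk_le_mk.2 hq.1
  have hcl : ∀ S ⊆ Q, IsClosed (⋃ q ∈ S, gridSquare c δ q) := fun S hS =>
    (hQfin.subset hS).isClosed_biUnion fun q _ => isClosed_gridSquare c δ q
  have hmeet : ∀ S ⊆ Q, S.Nonempty → (L ∩ ⋃ q ∈ S, gridSquare c δ q).Nonempty := by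
    rintro S hS ⟨q, hq⟩
    have hq' := hS hq
    rw [hQ] at hq'
    obtain ⟨z, hzL, hz⟩ := hq'.2
    exact ⟨z, hzL, Set.mem_biUnion hq hz⟩
  have hcov : L ⊆ (⋃ q ∈ D, gridSquare c δ q) ∪ ⋃ q ∈ Q \ D, gridSquare c δ q := by
    intro z hz
    obtain ⟨⟨h1, h2⟩, h3, h4⟩ := hbox hz
    obtain ⟨i, hi, hiz⟩ := exists_mem_Icc_grid hδ N h1 h2
    obtain ⟨j, hj, hjz⟩ := exists_mem_Icc_grid hδ N h3 h4
    have hzs : z ∈ gridSquare c δ (i, j) := ⟨hiz, hjz⟩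
    have hq : (i, j) ∈ Q := by rw [hQ]; exact ⟨⟨hi, hj⟩, z, hz, hzs⟩
    by_cases h : (i, j) ∈ D
    · exact .inl (Set.mem_biUnion h hzs)
    · exact .inr (Set.mem_biUnion (show (i, j) ∈ Q \ D from ⟨hq, h⟩) hzs)
  obtain ⟨z, hzL, hz1, hz2⟩ := isPreconnected_closed_iff.1 hL _ _ (hcl D hDQ)
    (hcl _ Set.sdiff_subset) hcov (hmeet D hDQ hD) (hmeet _ Set.sdiff_subset
      (Set.nonempty_of_ssubset (hDQ.ssubset_of_ne hne)))
  simp only [Set.mem_iUnion, exists_prop] at hz1 hz2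
  obtain ⟨⟨i, j⟩, hp, hzp⟩ := hz1
  obtain ⟨⟨i', j'⟩, hq, hzq⟩ := hz2
  have hpQ := hDQ hp
  have hqQ := hq.1
  have hi1 := grid_index_le_succ hδ hzp.1.1 hzq.1.2
  have hi2 := grid_index_le_succ hδ hzq.1.1 hzp.1.2
  have hj1 := grid_index_le_succ hδ hzp.2.1 hzq.2.2
  have hj2 := grid_index_le_succ hδ hzq.2.1 hzp.2.2
  simp only at hi1 hi2 hj1 hj2
  have hrQ : (i', j) ∈ Q := by
    rw [hQ] at hpQ hqQ ⊢
    exact ⟨⟨hqQ.1.1, hpQ.1.2⟩, z, hzL, hzq.1, hzp.2⟩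
  by_cases hr : (i', j) ∈ D
  · refine ⟨_, hr, _, hq, ?_⟩
    have : j ≠ j' := by rintro rfl; exact hq.2 hr
    simp only [SquareAdj, Prod.mk.injEq, true_and]
    omega
  · refine ⟨_, hp, _, ⟨hrQ, hr⟩, ?_⟩
    have : i ≠ i' := by rintro rfl; exact hr hp
    simp only [SquareAdj, Prod.mk.injEq, and_true]
    omega

/-- There is a retraction onto a closed square that maps the outside to the boundary. -/
theorem exists_clamp (M : ℝ) (hM : 0 ≤ M) : ∃ f : ℂ → ℂ, Continuous f ∧
    (∀ z, f z ∈ Set.Icc (-M) M ×ℂ Set.Icc (-M) M) ∧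
    (∀ z ∈ Set.Icc (-M) M ×ℂ Set.Icc (-M) M, f z = z) ∧
    ∀ z, f z = z ∨ f z ∉ Set.Ioo (-M) M ×ℂ Set.Ioo (-M) M := by
  refine ⟨fun z => ⟨max (-M) (min M z.re), max (-M) (min M z.im)⟩, ?_, ?_, ?_, ?_⟩
  · have h : ∀ z : ℂ, (⟨max (-M) (min M z.re), max (-M) (min M z.im)⟩ : ℂ) =
        Complex.equivRealProdCLM.symm (max (-M) (min M z.re), max (-M) (min M z.im)) :=
      fun z => rfl
    simp only [h]
    fun_prop
  · intro z
    constructor <;> simp [hM]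
  · rintro z ⟨⟨h1, h2⟩, h3, h4⟩
    apply Complex.ext <;> simp [h1, h2, h3, h4]
  · intro z
    by_cases hz : z ∈ Set.Ioo (-M) M ×ℂ Set.Ioo (-M) M
    · obtain ⟨⟨h1, h2⟩, h3, h4⟩ := hz
      left
      apply Complex.ext <;> simp [h1.le, h2.le, h3.le, h4.le]
    · right
      rintro ⟨⟨h1, h2⟩, h3, h4⟩
      refine hz ⟨⟨?_, ?_⟩, ?_, ?_⟩ <;> grind

/-- Let `U` be a connected open neighbourhood of infinity containing `Aᶜ` and disjoint from the
compact set `K`. Then every transport along straight segments of `A`, with values in a group, has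
a potential along `K`. A grid avoiding a connected subset of `U` is used: the transport, restricted
to the grid squares inside `A`, extends to a flat labelling of the whole grid. -/
theorem exists_potential {G : Type*} [Group G] {A K U : Set ℂ} (hA : IsOpen A) (hK : IsCompact K)
    (hKA : K ⊆ A) (hU : IsOpen U) (hUc : IsConnected U) (hUK : U ⊆ Kᶜ) (hAU : Aᶜ ⊆ U)
    (hUb : Bornology.IsBounded Uᶜ) (ℓ : ℂ → ℂ → G)
    (hℓ : ∀ C ⊆ A, Convex ℝ C → ∀ u ∈ C, ∀ v ∈ C, ∀ w ∈ C, ℓ u w = ℓ v w * ℓ u v) :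
    ∃ φ : ℂ → G, ∃ ε > 0, ∀ z ∈ K, ∀ w ∈ K, dist z w < ε → φ w = ℓ z w * φ z := by
  classical
  obtain ⟨M, hM, hMU⟩ := hUb.subset_ball_lt 0 0
  set B : Set ℂ := Set.Icc (-M) M ×ℂ Set.Icc (-M) M with hB
  set B' : Set ℂ := Set.Ioo (-M) M ×ℂ Set.Ioo (-M) M with hB'
  have hB'o : IsOpen B' := isOpen_Ioo.reProdIm isOpen_Ioo
  have hBU : B'ᶜ ⊆ U := by
    intro z hz
    by_contra hzU
    have h := hMU hzU
    rw [mem_ball_zero_iff] at h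
    exact hz ⟨abs_lt.1 ((Complex.abs_re_le_norm z).trans_lt h),
      abs_lt.1 ((Complex.abs_im_le_norm z).trans_lt h)⟩
  have hKB' : K ⊆ B' := fun z hz => by
    by_contra h
    exact hUK (hBU h) hz
  obtain ⟨L₀, hL₀c, hL₀, hCL₀, hL₀U⟩ := hU.exists_isCompact_isConnected_superset hUc
    (C := B \ (A ∩ B')) ((isCompact_Icc.reProdIm isCompact_Icc).diff (hA.inter hB'o)) (by
      rintro z ⟨-, hz⟩
      rcases not_and_or.1 hz with h | h
      exacts [hAU h, hBU h])
  obtain ⟨f, hf, hfB, hfid, hfB'⟩ := exists_clamp M hM.le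
  set L := f '' L₀ with hLdef
  have hLc : IsCompact L := hL₀c.image hf
  have hLconn : IsPreconnected L := hL₀.isPreconnected.image _ hf.continuousOn
  have hLB : L ⊆ B := by
    rintro _ ⟨z, -, rfl⟩
    exact hfB z
  have hLU : L ⊆ U := by
    rintro _ ⟨z, hz, rfl⟩
    rcases hfB' z with h | h
    · rw [h]; exact hL₀U hz
    · exact hBU h
  have hBL : B \ (A ∩ B') ⊆ L := by
    intro z hz
    exact ⟨z, hCL₀ hz, hfid z hz.1⟩
  obtain ⟨ε, hε, hεK⟩ := hK.exists_thickening_subset_open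
    ((hA.inter hB'o).inter hLc.isClosed.isOpen_compl)
    (fun z hz => ⟨⟨hKA hz, hKB' hz⟩, fun h => hUK (hLU h) hz⟩)
  have hball : ∀ z ∈ K, Metric.ball z ε ⊆ (A ∩ B') ∩ Lᶜ := fun z hz =>
    (Metric.ball_subset_thickening hz ε).trans hεK
  obtain ⟨N, hN⟩ := exists_nat_gt (20 * M / ε)
  set δ : ℝ := 2 * M / (N + 1) with hδdef
  have hN1 : (0 : ℝ) < N + 1 := by positivity
  have hδ : 0 < δ := by positivity
  have hδN : -M + δ * (N + 1) = M := by rw [hδdef]; field_simp; ring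
  have hδε : 10 * δ < ε := by
    rw [div_lt_iff₀ hε] at hN
    rw [hδdef, mul_div_assoc', div_lt_iff₀ hN1]
    nlinarith
  set Q : Set (ℕ × ℕ) := {q | (q.1 ≤ N ∧ q.2 ≤ N) ∧ (L ∩ gridSquare (-M) δ q).Nonempty} with hQ
  have hQfin : Q.Finite := (Set.finite_Iic ((N, N) : ℕ × ℕ)).subset fun q hq =>
    Prod.mk_le_mk.2 hq.1
  have hQ0 : ((0, 0) : ℕ × ℕ) ∈ Q := by
    refine ⟨⟨Nat.zero_le _, Nat.zero_le _⟩, ⟨-M, -M⟩, hBL ⟨?_, ?_⟩, ?_⟩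
    · simp [hB, Complex.mem_reProdIm, hM.le]
    · simp [hB', Complex.mem_reProdIm]
    · simp [gridSquare, Complex.mem_reProdIm, hδ.le]
  have hexact : FlatExact G Q := flatExact_of_connected G hQfin hQ0 fun D hDQ hD0 hne =>
    exists_squareAdj_of_isPreconnected hδ N hLconn (by rw [hδN]; exact hLB) hQ hDQ ⟨_, hD0⟩ hne
  let v := gridVertex (-M) δ
  have hvre : ∀ q, (v q).re = -M + δ * q.1 := fun q => rfl
  have hvim : ∀ q, (v q).im = -M + δ * q.2 := fun q => rfl
  have hlt : ∀ k : ℕ, -M + δ * k < M → k ≤ N := by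
    intro k hk
    have : δ * k < δ * ((N + 1 : ℕ) : ℝ) := by push_cast; linarith
    have : k < N + 1 := by exact_mod_cast lt_of_mul_lt_mul_left this hδ.le
    omega
  let H : ℕ × ℕ → G := fun q => if q.1 ≤ N ∧ q.2 ≤ N then ℓ (v q) (v (q.1 + 1, q.2)) else 1
  let V : ℕ × ℕ → G := fun q => if q.1 ≤ N ∧ q.2 ≤ N then ℓ (v q) (v (q.1, q.2 + 1)) else 1
  obtain ⟨h, hh⟩ := hexact H V (by
    rintro ⟨i, j⟩ hq
    by_cases hij : i ≤ N ∧ j ≤ N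
    · have hdisj : ∀ z ∈ gridSquare (-M) δ (i, j), z ∉ L := fun z hz hzL =>
        hq ⟨hij, z, hzL, hz⟩
      have hle : ∀ k : ℕ, k ≤ N → δ * (k + 1) ≤ δ * (N + 1) := fun k hk => by
        have : (k : ℝ) ≤ N := by exact_mod_cast hk
        nlinarith
      have hiN := hle i hij.1
      have hjN := hle j hij.2
      have hi0 : 0 ≤ δ * (i : ℝ) := by positivity
      have hj0 : 0 ≤ δ * (j : ℝ) := by positivity
      have hsub : gridSquare (-M) δ (i, j) ⊆ A ∩ B' := by
        intro z hz
        by_contra hcon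
        refine hdisj z hz (hBL ⟨?_, hcon⟩)
        obtain ⟨⟨h1, h2⟩, h3, h4⟩ := hz
        simp only at h1 h2 h3 h4
        exact ⟨⟨by linarith, by linarith⟩, by linarith, by linarith⟩
      have hmem : ∀ a b : ℕ, (a = i ∨ a = i + 1) → (b = j ∨ b = j + 1) →
          v (a, b) ∈ gridSquare (-M) δ (i, j) := by
        intro a b ha hb
        refine ⟨⟨?_, ?_⟩, ?_, ?_⟩ <;> simp only [hvre, hvim]
        · rcases ha with rfl | rfl <;> push_cast <;> linarith
        · rcases ha with rfl | rfl <;> push_cast <;> linarith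
        · rcases hb with rfl | rfl <;> push_cast <;> linarith
        · rcases hb with rfl | rfl <;> push_cast <;> linarith
      have hcorner := (hsub (hmem (i + 1) (j + 1) (.inr rfl) (.inr rfl))).2
      have hi1 : i + 1 ≤ N := hlt _ hcorner.1.2
      have hj1 : j + 1 ≤ N := hlt _ hcorner.2.2
      have hflat := fun a b ha hb => hℓ _ (hsub.trans Set.inter_subset_left)
        (convex_gridSquare (-M) δ (i, j)) _ (hmem i j (.inl rfl) (.inl rfl)) _ (hmem a b ha hb) _
        (hmem (i + 1) (j + 1) (.inr rfl) (.inr rfl))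
      simp only [FlatAt, H, V, hij.1, hij.2, hi1, hj1, and_self, if_true]
      rw [← hflat (i + 1) j (.inr rfl) (.inl rfl), ← hflat i (j + 1) (.inl rfl) (.inr rfl)]
    · have h1 : ¬ (i + 1 ≤ N ∧ j ≤ N) := by omega
      have h2 : ¬ (i ≤ N ∧ j + 1 ≤ N) := by omega
      simp only [FlatAt, H, V, hij, h1, h2, if_false])
  let near : ℂ → ℕ × ℕ → Prop := fun z q =>
    |(v q).re - z.re| ≤ 3 * δ ∧ |(v q).im - z.im| ≤ 3 * δ
  have hnorm : ∀ x y : ℂ, |x.re - y.re| ≤ 4 * δ → |x.im - y.im| ≤ 4 * δ →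
      x ∈ Metric.ball y ε := by
    intro x y h1 h2
    rw [Metric.mem_ball, dist_eq_norm]
    refine (Complex.norm_le_abs_re_add_abs_im _).trans_lt ?_
    simp only [Complex.sub_re, Complex.sub_im]
    linarith
  have hnear : ∀ {z q}, near z q → v q ∈ Metric.ball z ε := fun hq =>
    hnorm _ _ (hq.1.trans (by linarith)) (hq.2.trans (by linarith))
  have hstep : ∀ z ∈ K, ∀ q, near z q →
      h (q.1 + 1, q.2) = ℓ (v q) (v (q.1 + 1, q.2)) * h q ∧
      h (q.1, q.2 + 1) = ℓ (v q) (v (q.1, q.2 + 1)) * h q := by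
    intro z hz q hq
    have hvB := (hball z hz (hnear hq)).1.2
    have hqN : q.1 ≤ N ∧ q.2 ≤ N := ⟨hlt _ hvB.1.2, hlt _ hvB.2.2⟩
    have hqQ : q ∉ Q := by
      rintro ⟨-, x, hxL, ⟨h1, h2⟩, h3, h4⟩
      refine (hball z hz (hnorm x z ?_ ?_)).2 hxL
      · have := abs_le.1 hq.1
        rw [hvre] at this
        exact abs_le.2 ⟨by linarith, by linarith⟩
      · have := abs_le.1 hq.2
        rw [hvim] at this
        exact abs_le.2 ⟨by linarith, by linarith⟩
    simpa only [H, V, hqN, and_self, if_true] using hh q hqQ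
  let ind : ℂ → ℕ × ℕ := fun z => (⌊(z.re + M) / δ⌋₊, ⌊(z.im + M) / δ⌋₊)
  have hfloor : ∀ x : ℝ, -M < x →
      δ * ⌊(x + M) / δ⌋₊ ≤ x + M ∧ x + M < δ * (⌊(x + M) / δ⌋₊ + 1) := by
    intro x hx
    have h1 := Nat.floor_le (div_nonneg (by linarith : 0 ≤ x + M) hδ.le)
    have h2 := Nat.lt_floor_add_one ((x + M) / δ)
    rw [le_div_iff₀ hδ] at h1
    rw [div_lt_iff₀ hδ] at h2
    exact ⟨by linarith, by linarith⟩
  refine ⟨fun z => ℓ (v (ind z)) z * h (ind z), δ, hδ, fun z hz w hw hzw => ?_⟩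
  have hC := hℓ (Metric.ball z ε)
    ((hball z hz).trans (Set.inter_subset_left.trans Set.inter_subset_left)) (convex_ball _ _)
  have hrefl : ∀ u ∈ Metric.ball z ε, ℓ u u = 1 := fun u hu =>
    left_eq_mul.1 (hC u hu u hu u hu)
  have hsymm : ∀ p q, near z p → near z q → h q = ℓ (v p) (v q) * h p →
      h p = ℓ (v q) (v p) * h q := by
    intro p q hp hq heq
    rw [heq, ← mul_assoc, ← hC _ (hnear hp) _ (hnear hq) _ (hnear hp), hrefl _ (hnear hp), one_mul]
  have hhor : ∀ i i' j, near z (i, j) → near z (i', j) → i ≤ i' + 1 → i' ≤ i + 1 →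
      h (i', j) = ℓ (v (i, j)) (v (i', j)) * h (i, j) := by
    intro i i' j hp hq h1 h2
    obtain rfl | rfl | rfl : i' = i ∨ i' = i + 1 ∨ i = i' + 1 := by omega
    · rw [hrefl _ (hnear hp), one_mul]
    · exact (hstep z hz _ hp).1
    · exact hsymm _ _ hq hp (hstep z hz _ hq).1
  have hver : ∀ i j j', near z (i, j) → near z (i, j') → j ≤ j' + 1 → j' ≤ j + 1 →
      h (i, j') = ℓ (v (i, j)) (v (i, j')) * h (i, j) := by
    intro i j j' hp hq h1 h2
    obtain rfl | rfl | rfl : j' = j ∨ j' = j + 1 ∨ j = j' + 1 := by omega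
    · rw [hrefl _ (hnear hp), one_mul]
    · exact (hstep z hz _ hp).2
    · exact hsymm _ _ hq hp (hstep z hz _ hq).2
  have hre : |w.re - z.re| < δ := by
    rw [← Complex.sub_re]
    exact (Complex.abs_re_le_norm _).trans_lt (by rwa [dist_comm, dist_eq_norm] at hzw)
  have him : |w.im - z.im| < δ := by
    rw [← Complex.sub_im]
    exact (Complex.abs_im_le_norm _).trans_lt (by rwa [dist_comm, dist_eq_norm] at hzw)
  have hclose : ∀ x y : ℝ, -M < x → -M < y → |y - x| < δ →
      ⌊(x + M) / δ⌋₊ ≤ ⌊(y + M) / δ⌋₊ + 1 ∧ ⌊(y + M) / δ⌋₊ ≤ ⌊(x + M) / δ⌋₊ + 1 ∧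
      |-M + δ * ⌊(x + M) / δ⌋₊ - x| ≤ 3 * δ ∧ |-M + δ * ⌊(y + M) / δ⌋₊ - x| ≤ 3 * δ := by
    intro x y hx hy hxy
    obtain ⟨hx1, hx2⟩ := hfloor x hx
    obtain ⟨hy1, hy2⟩ := hfloor y hy
    obtain ⟨h1, h2⟩ := abs_lt.1 hxy
    have hle : ∀ a b : ℕ, δ * a < δ * (b + 1) + δ → a ≤ b + 1 := by
      intro a b hab
      have : δ * a < δ * ((b + 2 : ℕ) : ℝ) := by push_cast; linarith
      have : a < b + 2 := by exact_mod_cast lt_of_mul_lt_mul_left this hδ.le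
      omega
    exact ⟨hle _ _ (by linarith), hle _ _ (by linarith), abs_le.2 ⟨by linarith, by linarith⟩,
      abs_le.2 ⟨by linarith, by linarith⟩⟩
  obtain ⟨hi1, hi2, hi3, hi4⟩ := hclose z.re w.re (hKB' hz).1.1 (hKB' hw).1.1 hre
  obtain ⟨hj1, hj2, hj3, hj4⟩ := hclose z.im w.im (hKB' hz).2.1 (hKB' hw).2.1 him
  have hnz : near z (ind z) := ⟨hi3, hj3⟩
  have hnw : near z (ind w) := ⟨hi4, hj4⟩
  have hnm : near z ((ind w).1, (ind z).2) := ⟨hi4, hj3⟩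
  have hzz : z ∈ Metric.ball z ε := Metric.mem_ball_self hε
  have hww : w ∈ Metric.ball z ε := hnorm _ _ (by linarith) (by linarith)
  have h1 : h ((ind w).1, (ind z).2) = ℓ (v (ind z)) (v ((ind w).1, (ind z).2)) * h (ind z) :=
    hhor _ _ _ hnz hnm hi1 hi2
  have h2 : h (ind w) = ℓ (v ((ind w).1, (ind z).2)) (v (ind w)) * h ((ind w).1, (ind z).2) :=
    hver _ _ _ hnm hnw hj1 hj2
  simp only
  rw [h2, h1, ← mul_assoc (ℓ _ (v (ind w))), ← hC _ (hnear hnz) _ (hnear hnm) _ (hnear hnw),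
    ← mul_assoc, ← mul_assoc, ← hC _ (hnear hnz) _ (hnear hnw) _ hww,
    ← hC _ (hnear hnz) _ hzz _ hww]

/-- Let `A ⊆ ℂ` be open and let `γ` be a simple closed curve in `A` (a loop in `A`,
formalized as a `Path a a` in the subspace `A`, injective on `[0,1)`). If every
bounded connected component of `ℂ \ γ([0,1])` is contained in `A`, then `γ` is
null-homotopic in `A`. -/
theorem simple_closed_curve_nullhomotopic_of_bounded_components_subset (A : Set ℂ)
    (hA : IsOpen A) (a : A) (γ : Path a a)
    (hinj : Set.InjOn γ {t : unitInterval | (t : ℝ) < 1})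
    (hcomp : ∀ z : ℂ, z ∉ Set.range (fun t => (γ t : ℂ)) →
      Bornology.IsBounded (connectedComponentIn (Set.range fun t => (γ t : ℂ))ᶜ z) →
      connectedComponentIn (Set.range fun t => (γ t : ℂ))ᶜ z ⊆ A) :
    γ.Homotopic (Path.refl a) := by
  have hcont : Continuous fun t => (γ t : ℂ) := by fun_prop
  have hK : IsCompact (Set.range fun t => (γ t : ℂ)) := isCompact_range hcont
  have hKA : (Set.range fun t => (γ t : ℂ)) ⊆ A := Set.range_subset_iff.2 fun t => (γ t).2
  obtain ⟨U, hU, hUc, hUK, hAU, hUb⟩ := exists_unbounded_component hK hKA hcomp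
  refine γ.homotopic_refl_of_exists_potential hA fun ℓ hℓ => ?_
  obtain ⟨φ, ε, hε, hφ⟩ := exists_potential hA hK hKA hU hUc hUK hAU hUb ℓ hℓ
  exact ⟨φ, ε, hε, fun s t hst => hφ _ ⟨s, rfl⟩ _ ⟨t, rfl⟩ hst⟩
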